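/- Let n ≥ 1 and let G_n be the directed graph on vertex set T_{n,3} in which every point x with x₁ ≥ 1 has exactly two outgoing edges, to x − e₁ + e₂ and to x − e₁ + e₃; the bottom row consists of the n points bᵢ = (0, i−1, n−i) for 1 ≤ i ≤ n. Let (w_e)_{e ∈ edges of G_n} be complex numbers that are algebraically independent over ℚ. For each D ∈ T_{n,3} define v_D ∈ ℂⁿ by letting its i-th coordinate be the sum, over all directed paths P in G_n from D to bᵢ, of the product of the weights w_e of the edges of P (the empty path contributing 1). Then for every subset S ⊆ T_{n,3}, the family (v_D)_{D∈S} is linearly independent in ℂⁿ if and only if every simplex of size k in T_{n,3} contains at most k points of S, for all 1 ≤ k ≤ n. In particular, the path vectors v_D give a geometric representation of the matroid 𝒯_{n,3} over ℂ. -/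

import Mathlib

/-- The two outgoing steps of the graph `G_n`: from `x` (with `x₁ ≥ 1`) one can move
to `x - e₁ + e₂` (choice `0`) or to `x - e₁ + e₃` (choice `1`). -/
def stepv (x : Fin 3 → ℕ) (i : Fin 2) : Fin 3 → ℕ :=
  fun j => if j = 0 then x 0 - 1 else if (j : ℕ) = (i : ℕ) + 1 then x j + 1 else x j

/-- The position after `t` steps, starting at `D` and following the choices `c`. -/
def posv (D : Fin 3 → ℕ) (c : ℕ → Fin 2) : ℕ → (Fin 3 → ℕ)
  | 0 => D
  | t + 1 => stepv (posv D c t) (c t)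

/-- Extend a finite choice sequence to `ℕ`. -/
def extChoice (l : ℕ) (c : Fin l → Fin 2) : ℕ → Fin 2 :=
  fun t => if h : t < l then c ⟨t, h⟩ else 0

/-- The `i`-th point of the bottom row: `b_i = (0, i, n - 1 - i)` for `i : Fin n`. -/
def bottomPt (n : ℕ) (i : Fin n) : Fin 3 → ℕ :=
  fun j => if j = 0 then 0 else if j = 1 then (i : ℕ) else n - 1 - (i : ℕ)

/-- The path vector of a dot `D ∈ T_{n,3}`: its `i`-th coordinate is the sum, over
all directed paths in `G_n` from `D` to the bottom point `b_i`, of the product of the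
weights of the edges of the path. Paths from `D` have length `D 0` and correspond to
choice sequences `c : Fin (D 0) → Fin 2`. -/
noncomputable def pathVec (n : ℕ) (w : (Fin 3 → ℕ) → Fin 2 → ℂ) (D : Fin 3 → ℕ) :
    Fin n → ℂ := fun i =>
  ∑ c : Fin (D 0) → Fin 2,
    if posv D (extChoice (D 0) c) (D 0) = bottomPt n i then
      ∏ t : Fin (D 0), w (posv D (extChoice (D 0) c) (t : ℕ)) (c t)
    else 0

@[simp] lemma stepv_apply_zero (x : Fin 3 → ℕ) (i : Fin 2) : stepv x i 0 = x 0 - 1 := by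
  simp [stepv]

lemma stepv_zero_apply_one (x : Fin 3 → ℕ) : stepv x 0 1 = x 1 + 1 := by simp [stepv]

lemma stepv_zero_apply_two (x : Fin 3 → ℕ) : stepv x 0 2 = x 2 := by simp [stepv]

lemma stepv_one_apply_one (x : Fin 3 → ℕ) : stepv x 1 1 = x 1 := by simp [stepv]

lemma stepv_one_apply_two (x : Fin 3 → ℕ) : stepv x 1 2 = x 2 + 1 := by simp [stepv]

lemma sum_stepv (x : Fin 3 → ℕ) (i : Fin 2) (hx : 1 ≤ x 0) : ∑ j, stepv x i j = ∑ j, x j := by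
  fin_cases i
  · simp [Fin.sum_univ_three, stepv_zero_apply_one, stepv_zero_apply_two]; omega
  · simp [Fin.sum_univ_three, stepv_one_apply_one, stepv_one_apply_two]; omega

/-- The `i`-th coordinate of the path vector of `x`, computed recursively along paths with `l`
steps, over an arbitrary commutative semiring. -/
def pathSum {R : Type*} [CommSemiring R] (n : ℕ) (w : (Fin 3 → ℕ) → Fin 2 → R) :
    ℕ → (Fin 3 → ℕ) → Fin n → R
  | 0, x, i => if x = bottomPt n i then 1 else 0
  | l + 1, x, i => ∑ j, w x j * pathSum n w l (stepv x j) i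

lemma posv_succ_eq (D : Fin 3 → ℕ) (c : ℕ → Fin 2) (t : ℕ) :
    posv D c (t + 1) = posv (stepv D (c 0)) (fun s => c (s + 1)) t := by
  induction t with
  | zero => rfl
  | succ t ih => rw [posv, ih]; rfl

lemma posv_extChoice_cons (D : Fin 3 → ℕ) (l : ℕ) (j : Fin 2) (c : Fin l → Fin 2) (t : ℕ) :
    posv D (extChoice (l + 1) (Fin.cons j c)) (t + 1) = posv (stepv D j) (extChoice l c) t := by
  rw [posv_succ_eq]
  congr 1
  funext s
  by_cases h : s < l
  · rw [extChoice, extChoice, dif_pos h, dif_pos (Nat.succ_lt_succ h)]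
    rfl
  · simp [extChoice, h]

lemma sum_choices_eq_pathSum (n : ℕ) (w : (Fin 3 → ℕ) → Fin 2 → ℂ) (l : ℕ) (D : Fin 3 → ℕ)
    (i : Fin n) :
    (∑ c : Fin l → Fin 2,
      if posv D (extChoice l c) l = bottomPt n i then
        ∏ t : Fin l, w (posv D (extChoice l c) (t : ℕ)) (c t)
      else 0) = pathSum n w l D i := by
  induction l generalizing D with
  | zero => simp [posv, pathSum]
  | succ l ih =>
    rw [← (Fin.consEquiv fun _ : Fin (l + 1) => Fin 2).sum_comp, Fintype.sum_prod_type, pathSum]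
    refine Finset.sum_congr rfl fun j _ => ?_
    rw [← ih, Finset.mul_sum]
    refine Finset.sum_congr rfl fun c _ => ?_
    have h0 : posv D (extChoice (l + 1) (Fin.cons j c)) 0 = D := rfl
    have hc : Fin.consEquiv (fun _ : Fin (l + 1) => Fin 2) (j, c) = Fin.cons j c := rfl
    rw [hc, posv_extChoice_cons, Fin.prod_univ_succ, mul_ite, mul_zero]
    simp only [Fin.val_succ, posv_extChoice_cons, Fin.cons_succ]
    rfl

lemma pathVec_eq_pathSum (n : ℕ) (w : (Fin 3 → ℕ) → Fin 2 → ℂ) (D : Fin 3 → ℕ) :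
    pathVec n w D = pathSum n w (D 0) D :=
  funext fun i => sum_choices_eq_pathSum n w (D 0) D i

lemma map_pathSum {R R' : Type*} [CommSemiring R] [CommSemiring R'] (f : R →+* R') (n : ℕ)
    (w : (Fin 3 → ℕ) → Fin 2 → R) (w' : (Fin 3 → ℕ) → Fin 2 → R') (P : (Fin 3 → ℕ) → Prop)
    (hP : ∀ x i, P x → 1 ≤ x 0 → P (stepv x i))
    (hw : ∀ x i, P x → 1 ≤ x 0 → f (w x i) = w' x i)
    (l : ℕ) (x : Fin 3 → ℕ) (hl : x 0 = l) (hx : P x) (i : Fin n) :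
    f (pathSum n w l x i) = pathSum n w' l x i := by
  induction l generalizing x with
  | zero => simp only [pathSum]; split_ifs <;> simp
  | succ l ih =>
    simp only [pathSum, map_sum, map_mul]
    refine Finset.sum_congr rfl fun j _ => ?_
    rw [hw x j hx (by omega), ih (stepv x j) (by simp [hl]) (hP x j hx (by omega))]

lemma pathVec_step (n : ℕ) (w : (Fin 3 → ℕ) → Fin 2 → ℂ) (x : Fin 3 → ℕ) (hx : 1 ≤ x 0) :
    pathVec n w x = ∑ j, w x j • pathVec n w (stepv x j) := by
  obtain ⟨l, hl⟩ := Nat.exists_eq_add_of_le' hx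
  funext i
  simp [pathVec_eq_pathSum, hl, pathSum]

/-- The independent sets of the matroid `𝒯_{n,3}`. -/
def SimplexIndep (n : ℕ) (S : Finset (Fin 3 → ℕ)) : Prop :=
  ∀ (k : ℕ) (a : Fin 3 → ℕ), 1 ≤ k → k ≤ n → (∑ i, a i) + k = n →
    (S.filter fun x => ∀ i, a i ≤ x i).card ≤ k

/-- The path vector of a dot in a simplex lies in the span of the path vectors of the bottom row
of that simplex. -/
lemma pathVec_mem_span (n : ℕ) (w : (Fin 3 → ℕ) → Fin 2 → ℂ) (k : ℕ) (a : Fin 3 → ℕ)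
    (ha : (∑ i, a i) + k = n) (m : ℕ) (x : Fin 3 → ℕ) (hm : x 0 = a 0 + m)
    (hx : (∑ i, x i) + 1 = n) (hax : ∀ i, a i ≤ x i) :
    pathVec n w x ∈ Submodule.span ℂ
      (Set.range fun j : Fin k => pathVec n w ![a 0, a 1 + j, a 2 + (k - 1 - j)]) := by
  induction m generalizing x with
  | zero =>
    have h1 := hax 1
    have h2 := hax 2
    simp only [Fin.sum_univ_three] at ha hx
    refine Submodule.subset_span ⟨⟨x 1 - a 1, by omega⟩, congrArg (pathVec n w) ?_⟩
    funext i
    fin_cases i <;> simp <;> omega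
  | succ m ih =>
    rw [pathVec_step n w x (by omega)]
    refine Submodule.sum_mem _ fun j _ => Submodule.smul_mem _ _ (ih _ ?_ ?_ ?_)
    · simp; omega
    · rwa [sum_stepv x j (by omega)]
    · have h1 := hax 1
      have h2 := hax 2
      intro i
      fin_cases j <;> fin_cases i <;> simp [stepv] <;> omega

lemma simplexIndep_of_linearIndependent (n : ℕ) (w : (Fin 3 → ℕ) → Fin 2 → ℂ)
    (S : Finset (Fin 3 → ℕ)) (hS : ∀ x ∈ S, (∑ i, x i) + 1 = n)
    (h : LinearIndependent ℂ fun x : S => pathVec n w x.1) : SimplexIndep n S := by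
  intro k a _ _ ha
  set A := S.filter fun x => ∀ i, a i ≤ x i with hA
  have hAS : A ⊆ S := Finset.filter_subset _ _
  have hli : LinearIndependent ℂ fun x : A => pathVec n w x.1 :=
    h.comp (fun x : A => (⟨x.1, hAS x.2⟩ : S)) fun x y hxy =>
      Subtype.ext (congrArg (fun z : S => z.1) hxy)
  have hle : Submodule.span ℂ (Set.range fun x : A => pathVec n w x.1) ≤
      Submodule.span ℂ
        (Set.range fun j : Fin k => pathVec n w ![a 0, a 1 + j, a 2 + (k - 1 - j)]) := by
    rw [Submodule.span_le]
    rintro _ ⟨x, rfl⟩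
    obtain ⟨hxS, hax⟩ := Finset.mem_filter.1 x.2
    obtain ⟨m, hm⟩ := Nat.exists_eq_add_of_le (hax 0)
    exact pathVec_mem_span n w k a ha m x.1 hm (hS x.1 hxS) hax
  have hcard := Submodule.finrank_mono hle
  rw [finrank_span_eq_card hli] at hcard
  simpa using hcard.trans (finrank_range_le_card _)

/-- If replacing `x` by `y` destroys independence, then `y` lies in a simplex which is already
saturated by the remaining dots, and which does not contain `x`. -/
lemma SimplexIndep.exists_saturated {n : ℕ} {S : Finset (Fin 3 → ℕ)} (hI : SimplexIndep n S)
    {x y : Fin 3 → ℕ} (hx : x ∈ S) (hy : (∑ i, y i) + 1 = n)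
    (h : y ∉ S.erase x → ¬ SimplexIndep n (insert y (S.erase x))) :
    ∃ (k : ℕ) (a : Fin 3 → ℕ), (∑ i, a i) + k = n ∧ (∀ i, a i ≤ y i) ∧ (¬ ∀ i, a i ≤ x i) ∧
      k ≤ ((S.erase x).filter fun p => ∀ i, a i ≤ p i).card := by
  have key : ∃ (k : ℕ) (a : Fin 3 → ℕ), 1 ≤ k ∧ (∑ i, a i) + k = n ∧ (∀ i, a i ≤ y i) ∧
      k ≤ ((S.erase x).filter fun p => ∀ i, a i ≤ p i).card := by
    by_cases hyU : y ∈ S.erase x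
    · exact ⟨1, y, le_rfl, hy, fun _ => le_rfl,
        Finset.card_pos.2 ⟨y, Finset.mem_filter.2 ⟨hyU, fun _ => le_rfl⟩⟩⟩
    · have h' := h hyU
      simp only [SimplexIndep, not_forall, not_le] at h'
      obtain ⟨k, a, hk, hkn, ha, hlt⟩ := h'
      rw [Finset.filter_insert] at hlt
      split_ifs at hlt with hay
      · exact ⟨k, a, hk, ha, hay, by
          have := Finset.card_insert_le y ((S.erase x).filter fun p => ∀ i, a i ≤ p i)
          omega⟩
      · have := Finset.card_le_card
          (Finset.filter_subset_filter (fun p => ∀ i, a i ≤ p i) (S.erase_subset x))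
        have := hI k a hk hkn ha
        omega
  obtain ⟨k, a, hk, ha, hay, hcard⟩ := key
  refine ⟨k, a, ha, hay, fun hax => ?_, hcard⟩
  have hS := hI k a hk (by omega) ha
  rw [← Finset.insert_erase hx, Finset.filter_insert, if_pos hax,
    Finset.card_insert_of_notMem (by simp)] at hS
  omega

/-- Any dot outside the bottom row can be moved along one of its two edges so that independence
is preserved. -/
lemma SimplexIndep.exists_step {n : ℕ} {S : Finset (Fin 3 → ℕ)} (hI : SimplexIndep n S)
    {x : Fin 3 → ℕ} (hx : x ∈ S) (hS : ∀ p ∈ S, (∑ i, p i) + 1 = n)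
    (hx0 : 1 ≤ x 0) :
    ∃ i, stepv x i ∉ S.erase x ∧ SimplexIndep n (insert (stepv x i) (S.erase x)) := by
  have hxn := hS x hx
  by_contra! hcon
  obtain ⟨k, a, ha, hay, hax, hka⟩ :=
    hI.exists_saturated hx (by rwa [sum_stepv x 0 hx0]) (hcon 0)
  obtain ⟨l, b, hb, hbz, hbx, hlb⟩ :=
    hI.exists_saturated hx (by rwa [sum_stepv x 1 hx0]) (hcon 1)
  simp only [Fin.forall_fin_succ, Fin.isValue, IsEmpty.forall_iff, and_true, Fin.succ_zero_eq_one,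
    Fin.succ_one_eq_two, stepv_apply_zero, stepv_zero_apply_one, stepv_zero_apply_two,
    stepv_one_apply_one, stepv_one_apply_two] at hay hax hbz hbx
  simp only [Fin.sum_univ_three] at ha hb hxn
  set U := S.erase x
  set A := U.filter fun p => ∀ i, a i ≤ p i with hA
  set B := U.filter fun p => ∀ i, b i ≤ p i with hB
  have hinter : A ∩ B ⊆ U.filter fun p => ∀ i, max (a i) (b i) ≤ p i := by
    intro p
    simp only [hA, hB, Finset.mem_inter, Finset.mem_filter, max_le_iff]
    tauto
  have hunion : insert x (A ∪ B) ⊆ S.filter fun p => ∀ i, min (a i) (b i) ≤ p i := by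
    intro p hp
    simp only [hA, hB, Finset.mem_insert, Finset.mem_union, Finset.mem_filter] at hp ⊢
    rcases hp with rfl | ⟨hpU, hp⟩ | ⟨hpU, hp⟩
    · refine ⟨hx, fun i => ?_⟩
      fin_cases i <;> simp <;> omega
    · exact ⟨Finset.mem_of_mem_erase hpU, fun i => (min_le_left _ _).trans (hp i)⟩
    · exact ⟨Finset.mem_of_mem_erase hpU, fun i => (min_le_right _ _).trans (hp i)⟩
  have hxAB : x ∉ A ∪ B := by simp [hA, hB, U]
  have hU := Finset.card_le_card hunion
  rw [Finset.card_insert_of_notMem hxAB] at hU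
  have hAB := Finset.card_union_add_card_inter A B
  have hmin := hI (n - ∑ i, min (a i) (b i)) (fun i => min (a i) (b i))
    (by simp only [Fin.sum_univ_three]; omega) (Nat.sub_le _ _)
    (by simp only [Fin.sum_univ_three]; omega)
  have hcap : (A ∩ B).card ≤ n - ∑ i, max (a i) (b i) := by
    by_cases hs : ∑ i, max (a i) (b i) < n
    · have := hI (n - ∑ i, max (a i) (b i)) (fun i => max (a i) (b i)) (by omega)
        (Nat.sub_le _ _) (by omega)
      exact (Finset.card_le_card (hinter.trans
        (Finset.filter_subset_filter _ (S.erase_subset x)))).trans this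
    · refine (Finset.card_eq_zero.2 (Finset.eq_empty_of_forall_notMem fun p hp => ?_)).trans_le
        (Nat.zero_le _)
      obtain ⟨hpU, hp⟩ := Finset.mem_filter.1 (hinter hp)
      have := Finset.sum_le_sum fun i (_ : i ∈ Finset.univ) => hp i
      have := hS p (Finset.mem_of_mem_erase hpU)
      omega
  simp only [Fin.sum_univ_three] at hmin hcap
  omega

/-- For an independent set `S` there are weights for which the path vectors of the dots of `S` are
distinct standard basis vectors. -/
lemma SimplexIndep.exists_routing {n : ℕ} (m : ℕ) (S : Finset (Fin 3 → ℕ))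
    (hm : ∑ x ∈ S, x 0 = m) (hI : SimplexIndep n S) (hS : ∀ x ∈ S, (∑ i, x i) + 1 = n) :
    ∃ (w : (Fin 3 → ℕ) → Fin 2 → ℚ) (g : (Fin 3 → ℕ) → ℕ), Set.InjOn g S ∧
      ∀ x ∈ S, g x < n ∧ ∀ i : Fin n, pathSum n w (x 0) x i = if g x = i then 1 else 0 := by
  induction m generalizing S with
  | zero =>
    have h0 : ∀ x ∈ S, x 0 = 0 := Finset.sum_eq_zero_iff.1 hm
    refine ⟨0, fun x => x 1, fun x hx y hy hxy => ?_, fun x hx => ?_⟩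
    · have := h0 x hx
      have := h0 y hy
      have hxn := hS x hx
      have hyn := hS y hy
      simp only [Fin.sum_univ_three] at hxn hyn hxy
      funext i
      fin_cases i <;> simp <;> omega
    · have hx0 := h0 x hx
      have hxn := hS x hx
      simp only [Fin.sum_univ_three] at hxn
      refine ⟨by dsimp only; omega, fun i => ?_⟩
      rw [hx0, pathSum]
      refine if_congr ⟨fun h => ?_, fun h => ?_⟩ rfl rfl
      · simpa [bottomPt] using congrFun h 1
      · dsimp only at h
        funext j
        fin_cases j <;> simp [bottomPt] <;> omega
  | succ m ih =>
    have hne : S.Nonempty := by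
      rw [Finset.nonempty_iff_ne_empty]
      rintro rfl
      simp at hm
    obtain ⟨x, hx, hmax⟩ := S.exists_max_image (fun x => x 0) hne
    have hx0 : 1 ≤ x 0 := by
      by_contra hlt
      have : ∑ x ∈ S, x 0 = 0 := Finset.sum_eq_zero fun y hy => by
        have := hmax y hy
        omega
      omega
    obtain ⟨j, hj, hI'⟩ := hI.exists_step hx hS hx0
    have hsum := Finset.add_sum_erase S (fun x => x 0) hx
    obtain ⟨w, g, hg, hw⟩ := ih (insert (stepv x j) (S.erase x))
      (by rw [Finset.sum_insert hj, stepv_apply_zero]; omega) hI' (by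
        intro y hy
        rcases Finset.mem_insert.1 hy with rfl | hy
        · rw [sum_stepv x j hx0]; exact hS x hx
        · exact hS y (Finset.mem_of_mem_erase hy))
    have hcongr : ∀ y, y ≠ x → y 0 ≤ x 0 → ∀ i : Fin n,
        pathSum n (Function.update w x (Pi.single j 1)) (y 0) y i = pathSum n w (y 0) y i := by
      intro y hyx hy i
      refine map_pathSum (RingHom.id ℚ) n _ _ (fun y => y ≠ x ∧ y 0 ≤ x 0) ?_ ?_ _ y rfl
        ⟨hyx, hy⟩ i
      · rintro z s ⟨-, hz⟩ hz0
        have hlt : stepv z s 0 < x 0 := by rw [stepv_apply_zero]; omega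
        exact ⟨fun h => by rw [h] at hlt; exact hlt.false, hlt.le⟩
      · rintro z s ⟨hz, -⟩ -
        simp [Function.update_of_ne hz]
    have hstep : stepv x j ≠ x := fun h => by
      have := congrFun h 0
      rw [stepv_apply_zero] at this
      omega
    refine ⟨Function.update w x (Pi.single j 1), Function.update g x (g (stepv x j)), ?_, ?_⟩
    · rw [← Finset.insert_erase hx, Finset.coe_insert, Set.injOn_insert (by simp)]
      rw [Finset.coe_insert, Set.injOn_insert (Finset.mem_coe.not.2 hj)] at hg
      have heq : Set.EqOn (Function.update g x (g (stepv x j))) g (S.erase x : Finset _) :=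
        fun y hy => Function.update_of_ne (Finset.ne_of_mem_erase hy) _ _
      rw [heq.injOn_iff, heq.image_eq, Function.update_self]
      exact hg
    · intro y hy
      by_cases hyx : y = x
      · subst hyx
        have hw' := hw (stepv y j) (Finset.mem_insert_self _ _)
        rw [Function.update_self]
        refine ⟨hw'.1, fun i => ?_⟩
        rw [← hw'.2 i, ← hcongr (stepv y j) hstep (by simp) i]
        obtain ⟨l, hl⟩ := Nat.exists_eq_add_of_le' hx0
        rw [stepv_apply_zero, hl, pathSum, Finset.sum_eq_single j]
        · simp
        · intro s _ hs
          simp [hs]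
        · simp
      · rw [Function.update_of_ne hyx]
        have hw' := hw y (Finset.mem_insert_of_mem (Finset.mem_erase.2 ⟨hyx, hy⟩))
        exact ⟨hw'.1, fun i => by rw [hcongr y hyx (hmax y hy), hw'.2 i]⟩

lemma linearIndependent_of_simplexIndep (n : ℕ) (w : (Fin 3 → ℕ) → Fin 2 → ℂ)
    (hw : AlgebraicIndependent ℚ
      (fun e : {e : (Fin 3 → ℕ) × Fin 2 // (∑ i, e.1 i) + 1 = n ∧ 1 ≤ e.1 0} =>
        w e.1.1 e.1.2))
    (S : Finset (Fin 3 → ℕ)) (hS : ∀ x ∈ S, (∑ i, x i) + 1 = n) (hI : SimplexIndep n S) :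
    LinearIndependent ℂ (fun x : S => pathVec n w x.1) := by
  obtain ⟨w', g, hg, hw'⟩ := SimplexIndep.exists_routing _ S rfl hI hS
  let col : S → Fin n := fun x => ⟨g x.1, (hw' x.1 x.2).1⟩
  let E := {e : (Fin 3 → ℕ) × Fin 2 // (∑ i, e.1 i) + 1 = n ∧ 1 ≤ e.1 0}
  let W : (Fin 3 → ℕ) → Fin 2 → MvPolynomial E ℚ := fun x i =>
    if h : (∑ j, x j) + 1 = n ∧ 1 ≤ x 0 then MvPolynomial.X ⟨(x, i), h⟩ else 0
  let M : Matrix S S (MvPolynomial E ℚ) :=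
    Matrix.of fun x y => pathSum n W (x.1 0) x.1 (col y)
  have hclosed : ∀ (x : Fin 3 → ℕ) (i : Fin 2), (∑ j, x j) + 1 = n → 1 ≤ x 0 →
      (∑ j, stepv x i j) + 1 = n := fun x i hx hx0 => by rwa [sum_stepv x i hx0]
  have hone : (MvPolynomial.aeval fun e : E => w' e.1.1 e.1.2).toRingHom.mapMatrix M = 1 := by
    ext x y
    have := map_pathSum (MvPolynomial.aeval (R := ℚ) fun e : E => w' e.1.1 e.1.2).toRingHom n W w'
      (fun x => (∑ j, x j) + 1 = n) hclosed (fun x i hx hx0 => by simp [W, hx, hx0])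
      (x.1 0) x.1 rfl (hS x.1 x.2) (col y)
    refine this.trans ?_
    rw [(hw' x.1 x.2).2, Matrix.one_apply]
    exact if_congr ⟨fun h => Subtype.ext (hg x.2 y.2 h), fun h => by rw [h]⟩ rfl rfl
  have hdet : M.det ≠ 0 := by
    intro h
    have := congrArg Matrix.det hone
    rw [← RingHom.map_det, h] at this
    simp at this
  have hdet' : ((MvPolynomial.aeval fun e : E => w e.1.1 e.1.2).toRingHom.mapMatrix M).det ≠ 0 := by
    rw [← RingHom.map_det]
    exact fun h => hdet ((injective_iff_map_eq_zero _).1 hw _ h)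
  have hrows := Matrix.linearIndependent_rows_of_det_ne_zero hdet'
  refine LinearIndependent.of_comp (LinearMap.funLeft ℂ ℂ col) ?_
  suffices h : (LinearMap.funLeft ℂ ℂ col ∘ fun x : S => pathVec n w x.1) =
      ((MvPolynomial.aeval fun e : E => w e.1.1 e.1.2).toRingHom.mapMatrix M).row by
    rw [h]; exact hrows
  funext x y
  have := map_pathSum (MvPolynomial.aeval (R := ℚ) fun e : E => w e.1.1 e.1.2).toRingHom n W w
    (fun x => (∑ j, x j) + 1 = n) hclosed (fun x i hx hx0 => by simp [W, hx, hx0])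
    (x.1 0) x.1 rfl (hS x.1 x.2) (col y)
  simp only [Function.comp, LinearMap.funLeft_apply, pathVec_eq_pathSum]
  exact this.symm

/-- If the edge weights of `G_n` are algebraically independent over `ℚ`, then the
path vectors represent the matroid `𝒯_{n,3}`: a family `(v_D)_{D ∈ S}` is linearly
independent iff every simplex of size `k` in `T_{n,3}` contains at most `k` points
of `S`. -/
theorem stmt9 (n : ℕ) (hn : 1 ≤ n) (w : (Fin 3 → ℕ) → Fin 2 → ℂ)
    (hw : AlgebraicIndependent ℚ
      (fun e : {e : (Fin 3 → ℕ) × Fin 2 // (∑ i, e.1 i) + 1 = n ∧ 1 ≤ e.1 0} =>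
        w e.1.1 e.1.2)) :
    ∀ S : Finset (Fin 3 → ℕ), (∀ x ∈ S, (∑ i, x i) + 1 = n) →
      (LinearIndependent ℂ (fun x : S => pathVec n w x.1) ↔
        ∀ (k : ℕ) (a : Fin 3 → ℕ), 1 ≤ k → k ≤ n → (∑ i, a i) + k = n →
          (S.filter fun x => ∀ i, a i ≤ x i).card ≤ k) := by
  exact fun S hS => ⟨simplexIndep_of_linearIndependent n w S hS,
    linearIndependent_of_simplexIndep n w hw S hS⟩
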